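/- arXiv:2011.14335 — 3 statements merged into one kernel-verified Lean document; each statement's English description precedes it below -/
import Mathlib

section
/- Let S be an inverse semigroup and let (X, p) be a supported left S-action. If x, y ∈ X are left compatible (i.e. p(x)y = p(y)x), then for every s ∈ S the elements sx and sy are left compatible (i.e. p(sx)(sy) = p(sy)(sx)). -/
namespace PseudogroupMorita

/-- An inverse semigroup: a semigroup in which every element `a` has a unique
inverse `a⁻¹` satisfying `a * a⁻¹ * a = a` and `a⁻¹ * a * a⁻¹ = a⁻¹`. -/
class InverseSemigroup (S : Type*) extends Semigroup S, Inv S where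
  mul_inv_mul : ∀ a : S, a * a⁻¹ * a = a
  inv_mul_inv : ∀ a : S, a⁻¹ * a * a⁻¹ = a⁻¹
  inv_unique : ∀ a b : S, a * b * a = a → b * a * b = b → b = a⁻¹

/-- `a` is an idempotent. -/
def IsIdem {S : Type*} [Mul S] (a : S) : Prop := a * a = a

/-- The natural partial order: `a ≤ b` iff `a = e * b` for some idempotent `e`. -/
def nle {S : Type*} [Mul S] (a b : S) : Prop := ∃ e : S, IsIdem e ∧ a = e * b

/-- `s` and `t` are left compatible: `s⁻¹ * t` is an idempotent. -/
def LeftCompat {S : Type*} [Mul S] [Inv S] (s t : S) : Prop := IsIdem (s⁻¹ * t)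

/-- `s` and `t` are right compatible: `s * t⁻¹` is an idempotent. -/
def RightCompat {S : Type*} [Mul S] [Inv S] (s t : S) : Prop := IsIdem (s * t⁻¹)

/-- `s` and `t` are compatible. -/
def Compat {S : Type*} [Mul S] [Inv S] (s t : S) : Prop := LeftCompat s t ∧ RightCompat s t

/-- A compatible subset: any two of its elements are compatible. -/
def CompatSet {S : Type*} [Mul S] [Inv S] (A : Set S) : Prop := ∀ a ∈ A, ∀ b ∈ A, Compat a b

/-- `j` is the join (least upper bound) of `A` with respect to the natural partial order. -/
def IsJoin {S : Type*} [Mul S] (A : Set S) (j : S) : Prop :=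
  (∀ a ∈ A, nle a j) ∧ ∀ b : S, (∀ a ∈ A, nle a b) → nle j b

/-- A pseudogroup: an inverse semigroup in which every compatible subset has a join
and multiplication distributes over such joins. -/
class Pseudogroup (S : Type*) extends InverseSemigroup S where
  joins_exist : ∀ A : Set S, CompatSet A → ∃ j : S, IsJoin A j
  mul_join_left : ∀ (s : S) (A : Set S) (j : S), CompatSet A → IsJoin A j →
    IsJoin ((fun a => s * a) '' A) (s * j)
  mul_join_right : ∀ (s : S) (A : Set S) (j : S), CompatSet A → IsJoin A j →
    IsJoin ((fun a => a * s) '' A) (j * s)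

/-- `A^∨`: the set of all joins of compatible subsets of `A`. -/
def supClosure {S : Type*} [Mul S] [Inv S] (A : Set S) : Set S :=
  {j | ∃ C : Set S, C ⊆ A ∧ CompatSet C ∧ IsJoin C j}

/-- The underlying set of the local semigroup `eSe`. -/
def locSet {S : Type*} [Mul S] (e : S) : Set S := {u : S | u = e * u * e}

/-- The set `A * B * C` of triple products. -/
def tripleProd {S : Type*} [Mul S] (A B C : Set S) : Set S :=
  {x : S | ∃ a ∈ A, ∃ b ∈ B, ∃ c ∈ C, x = a * b * c}

/-- A (two-sided) semigroup ideal. -/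
def SemigroupIdeal {S : Type*} [Mul S] (I : Set S) : Prop :=
  ∀ s : S, ∀ a ∈ I, s * a ∈ I ∧ a * s ∈ I

/-- A sup-ideal: an ideal closed under arbitrary compatible joins. -/
def IsSupIdeal {S : Type*} [Mul S] [Inv S] (I : Set S) : Prop :=
  SemigroupIdeal I ∧ ∀ C : Set S, C ⊆ I → CompatSet C → ∀ j : S, IsJoin C j → j ∈ I

/-- A pencil from `e` to `f`: a subset `X` with `e = ⋁_{x ∈ X} d x` and `f ≥ ⋁_{x ∈ X} r x`. -/
def IsPencil {S : Type*} [Mul S] [Inv S] (X : Set S) (e f : S) : Prop :=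
  IsJoin ((fun x => x⁻¹ * x) '' X) e ∧
  ∃ j : S, IsJoin ((fun x => x * x⁻¹) '' X) j ∧ nle j f

/-- `e ⪯ f` iff there is a pencil from `e` to `f`. -/
def PencilLE {S : Type*} [Mul S] [Inv S] (e f : S) : Prop := ∃ X : Set S, IsPencil X e f

/-- A sup-ideal of the (local) pseudogroup whose underlying set is `A`. -/
def IsSupIdealIn {S : Type*} [Mul S] [Inv S] (A I : Set S) : Prop :=
  I ⊆ A ∧ (∀ s ∈ A, ∀ a ∈ I, s * a ∈ I ∧ a * s ∈ I) ∧
  ∀ C : Set S, C ⊆ I → CompatSet C → ∀ j : S, IsJoin C j → j ∈ I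

/-- The (local) pseudogroup with underlying set `A` and least element `z` is 0-simplifying:
its only sup-ideals are `{z}` and `A` itself. -/
def ZeroSimplifyingIn {S : Type*} [Mul S] [Inv S] (A : Set S) (z : S) : Prop :=
  ∀ I : Set S, IsSupIdealIn A I → I = {z} ∨ I = A

/-- The (local) inverse semigroup with underlying set `A` is fundamental: any of its
elements commuting with all of its idempotents is an idempotent. -/
def FundamentalIn {S : Type*} [Mul S] (A : Set S) : Prop :=
  ∀ a ∈ A, (∀ g ∈ A, IsIdem g → a * g = g * a) → IsIdem a

/-- A supported left action of an inverse semigroup `S` on a set `X`. -/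
structure SupportedAction (S : Type*) [InverseSemigroup S] (X : Type*) where
  act : S → X → X
  act_mul : ∀ (s t : S) (x : X), act (s * t) x = act s (act t x)
  p : X → S
  p_idem : ∀ x : X, IsIdem (p x)
  p_act : ∀ x : X, act (p x) x = x
  p_conj : ∀ (s : S) (x : X), p (act s x) = s * p x * s⁻¹

namespace SupportedAction

variable {S : Type*} [InverseSemigroup S] {X Y : Type*}

/-- `x` and `y` are left compatible: `p(x) y = p(y) x`. -/
def LCompat (M : SupportedAction S X) (x y : X) : Prop :=
  M.act (M.p x) y = M.act (M.p y) x

/-- A left compatible subset of `X`. -/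
def LCompatSet (M : SupportedAction S X) (A : Set X) : Prop :=
  ∀ x ∈ A, ∀ y ∈ A, M.LCompat x y

/-- The order on `X`: `x ≤ y` iff `x = e • y` for some idempotent `e`. -/
def xle (M : SupportedAction S X) (x y : X) : Prop :=
  ∃ e : S, IsIdem e ∧ x = M.act e y

/-- `j` is the join of `A ⊆ X`. -/
def IsJoinX (M : SupportedAction S X) (A : Set X) (j : X) : Prop :=
  (∀ a ∈ A, M.xle a j) ∧ ∀ b : X, (∀ a ∈ A, M.xle a b) → M.xle j b

/-- `m` is the (binary) meet of `x` and `y` in `X`. -/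
def IsMeetX (M : SupportedAction S X) (x y m : X) : Prop :=
  M.xle m x ∧ M.xle m y ∧ ∀ z : X, M.xle z x → M.xle z y → M.xle z m

/-- The action is pointed, with minimum `z ∈ X` and `zS` the least element of `S`:
`s • z = z` and `zS • x = z`. -/
def Pointed (M : SupportedAction S X) (z : X) (zS : S) : Prop :=
  (∀ x : X, M.xle z x) ∧ (∀ s : S, M.act s z = z) ∧ (∀ x : X, M.act zS x = z)

/-- A homomorphism of supported left `S`-actions. -/
def IsActHom (M : SupportedAction S X) (N : SupportedAction S Y) (θ : X → Y) : Prop :=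
  (∀ (s : S) (x : X), θ (M.act s x) = N.act s (θ x)) ∧ ∀ x : X, N.p (θ x) = M.p x

end SupportedAction

/-- A left `S`-module over a pseudogroup `S`: a supported left action such that every
left compatible subset of `X` has a join, the action distributes over left compatible
joins, and joins of compatible subsets of `S` act as joins. -/
structure SMod (S : Type*) [Pseudogroup S] (X : Type*) extends SupportedAction S X where
  joinsX : ∀ A : Set X, toSupportedAction.LCompatSet A → ∃ j : X, toSupportedAction.IsJoinX A j
  act_joinX : ∀ (s : S) (A : Set X) (j : X), toSupportedAction.LCompatSet A →
    toSupportedAction.IsJoinX A j →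
    toSupportedAction.IsJoinX (toSupportedAction.act s '' A) (toSupportedAction.act s j)
  join_act : ∀ (A : Set S) (j : S), CompatSet A → IsJoin A j → ∀ x : X,
    toSupportedAction.IsJoinX ((fun s => toSupportedAction.act s x) '' A)
      (toSupportedAction.act j x)

/-- A homomorphism of left `S`-modules: a homomorphism of the underlying supported
actions preserving all left compatible joins. -/
def IsModHom {S X Y : Type*} [Pseudogroup S] (M : SMod S X) (N : SMod S Y) (θ : X → Y) : Prop :=
  SupportedAction.IsActHom M.toSupportedAction N.toSupportedAction θ ∧
  ∀ (A : Set X) (j : X), M.toSupportedAction.LCompatSet A → M.toSupportedAction.IsJoinX A j →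
    N.toSupportedAction.IsJoinX (θ '' A) (θ j)

/-- `L(X)`: the set of left compatible order-ideals of a supported action `X`. -/
abbrev LIdeal {S : Type*} [InverseSemigroup S] {X : Type*} (M : SupportedAction S X) : Type _ :=
  {A : Set X // (∀ x y : X, M.xle x y → y ∈ A → x ∈ A) ∧ M.LCompatSet A}

/-- An `(S,T)`-biaction with inner products. -/
structure Biaction (S T : Type*) [InverseSemigroup S] [InverseSemigroup T] (X : Type*) where
  actL : S → X → X
  actL_mul : ∀ (s t : S) (x : X), actL (s * t) x = actL s (actL t x)
  actR : X → T → X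
  actR_mul : ∀ (x : X) (t u : T), actR x (t * u) = actR (actR x t) u
  actLR : ∀ (s : S) (x : X) (t : T), actR (actL s x) t = actL s (actR x t)
  ip : X → X → S
  iq : X → X → T
  ip_actL : ∀ (s : S) (x y : X), ip (actL s x) y = s * ip x y
  ip_symm : ∀ x y : X, ip y x = (ip x y)⁻¹
  ip_self_act : ∀ x : X, actL (ip x x) x = x
  iq_actR : ∀ (x y : X) (t : T), iq x (actR y t) = iq x y * t
  iq_symm : ∀ x y : X, iq y x = (iq x y)⁻¹
  iq_self_act : ∀ x : X, actR x (iq x x) = x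
  ip_iq_assoc : ∀ x y z : X, actL (ip x y) z = actR x (iq y z)

namespace Biaction

variable {S T : Type*} [InverseSemigroup S] [InverseSemigroup T] {X : Type*}

/-- Left compatibility in a biaction: `p(x) y = p(y) x` with `p x = ⟨x,x⟩`. -/
def LCompatX (B : Biaction S T X) (x y : X) : Prop :=
  B.actL (B.ip x x) y = B.actL (B.ip y y) x

/-- Right compatibility in a biaction: `x q(y) = y q(x)` with `q x = [x,x]`. -/
def RCompatX (B : Biaction S T X) (x y : X) : Prop :=
  B.actR x (B.iq y y) = B.actR y (B.iq x x)

/-- Compatibility in a biaction. -/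
def CompatX (B : Biaction S T X) (x y : X) : Prop := B.LCompatX x y ∧ B.RCompatX x y

/-- A compatible subset of `X`. -/
def CompatSetX (B : Biaction S T X) (A : Set X) : Prop := ∀ x ∈ A, ∀ y ∈ A, B.CompatX x y

/-- The order on `X`: `x ≤ y` iff `x = e • y` for some idempotent `e ∈ S`. -/
def bxle (B : Biaction S T X) (x y : X) : Prop := ∃ e : S, IsIdem e ∧ x = B.actL e y

/-- `j` is the join of `A ⊆ X`. -/
def IsJoinBX (B : Biaction S T X) (A : Set X) (j : X) : Prop :=
  (∀ a ∈ A, B.bxle a j) ∧ ∀ b : X, (∀ a ∈ A, B.bxle a b) → B.bxle j b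

end Biaction

/-- An `(S,T)`-bimodule over pseudogroups `S` and `T`. -/
structure Bimodule (S T : Type*) [Pseudogroup S] [Pseudogroup T] (X : Type*) extends
    Biaction S T X where
  joinsX : ∀ A : Set X, toBiaction.CompatSetX A → ∃ j : X, toBiaction.IsJoinBX A j
  distL : ∀ (s : S) (A : Set X) (j : X), toBiaction.CompatSetX A → toBiaction.IsJoinBX A j →
    toBiaction.IsJoinBX (toBiaction.actL s '' A) (toBiaction.actL s j)
  distSL : ∀ (A : Set S) (j : S), CompatSet A → IsJoin A j → ∀ x : X,
    toBiaction.IsJoinBX ((fun s => toBiaction.actL s x) '' A) (toBiaction.actL j x)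
  distR : ∀ (t : T) (A : Set X) (j : X), toBiaction.CompatSetX A → toBiaction.IsJoinBX A j →
    toBiaction.IsJoinBX ((fun x => toBiaction.actR x t) '' A) (toBiaction.actR j t)
  distTR : ∀ (A : Set T) (j : T), CompatSet A → IsJoin A j → ∀ x : X,
    toBiaction.IsJoinBX ((fun t => toBiaction.actR x t) '' A) (toBiaction.actR x j)
  distIP : ∀ (A : Set X) (j : X), toBiaction.CompatSetX A → toBiaction.IsJoinBX A j → ∀ y : X,
    IsJoin ((fun x => toBiaction.ip x y) '' A) (toBiaction.ip j y)
  distIQ : ∀ (A : Set X) (j : X), toBiaction.CompatSetX A → toBiaction.IsJoinBX A j → ∀ y : X,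
    IsJoin ((fun x => toBiaction.iq y x) '' A) (toBiaction.iq y j)

/-- An `(S,T)`-equivalence bimodule: an `(S,T)`-bimodule satisfying both covering
conditions `⋁_{x∈X} ⟨x,x⟩ = e_S` and `⋁_{x∈X} [x,x] = e_T`
(where `e_S = ⋁ E(S)` and `e_T = ⋁ E(T)`). -/
structure EquivBimodule (S T : Type*) [Pseudogroup S] [Pseudogroup T] (X : Type*) extends
    Bimodule S T X where
  coverS : ∀ jS : S, IsJoin {e : S | IsIdem e} jS →
    IsJoin (Set.range fun x : X => toBimodule.toBiaction.ip x x) jS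
  coverT : ∀ jT : T, IsJoin {e : T | IsIdem e} jT →
    IsJoin (Set.range fun x : X => toBimodule.toBiaction.iq x x) jT


theorem aux_idem_mul {S : Type*} [InverseSemigroup S] {e f : S} (he : IsIdem e)
    (hf : IsIdem f) : IsIdem (e * f) := by
  unfold IsIdem at he hf
  have he' : ∀ z, e * (e * z) = e * z := fun z => by rw [← mul_assoc, he]
  have hf' : ∀ z, f * (f * z) = f * z := fun z => by rw [← mul_assoc, hf]
  have h1 := InverseSemigroup.mul_inv_mul (e * f)
  have h2 := InverseSemigroup.inv_mul_inv (e * f)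
  have h3 := InverseSemigroup.inv_unique (e * f) (f * (e * f)⁻¹ * e)
  have h4 := InverseSemigroup.inv_unique (e * f)⁻¹ (e * f) h2 h1
  have h5 := InverseSemigroup.inv_unique (e * f)⁻¹ (e * f)⁻¹
  generalize (e * f)⁻¹ = a at *
  simp only [mul_assoc] at h1 h2
  have h2' : ∀ z, a * (e * (f * (a * z))) = a * z := fun z => by
    simpa only [mul_assoc] using congrArg (· * z) h2
  have h6 : f * a * e = a := by
    apply h3
    · simp only [mul_assoc, he', hf', h1]
    · simp only [mul_assoc, he', hf', h2']
  have h7 : a * a = a := by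
    calc a * a = (f * a * e) * (f * a * e) := by rw [h6]
      _ = f * a * e := by simp only [mul_assoc, h2']
      _ = a := h6
  have h8 : a = a⁻¹ := h5 (by rw [h7, h7]) (by rw [h7, h7])
  unfold IsIdem
  rw [h4, ← h8, h7]

theorem aux_idem_comm {S : Type*} [InverseSemigroup S] {e f : S} (he : IsIdem e)
    (hf : IsIdem f) : e * f = f * e := by
  have h1 : e * f * (e * f) = e * f := aux_idem_mul he hf
  have h2 : f * e * (f * e) = f * e := aux_idem_mul hf he
  unfold IsIdem at he hf
  have he' : ∀ z, e * (e * z) = e * z := fun z => by rw [← mul_assoc, he]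
  have hf' : ∀ z, f * (f * z) = f * z := fun z => by rw [← mul_assoc, hf]
  have h3 := InverseSemigroup.inv_unique (e * f) (e * f) (by rw [h1, h1]) (by rw [h1, h1])
  have h4 := InverseSemigroup.inv_unique (e * f) (f * e)
    (by simp only [mul_assoc] at h1 ⊢; simp only [he', hf', h1])
    (by simp only [mul_assoc] at h2 ⊢; simp only [he', hf', h2])
  rw [h4, ← h3]

theorem aux_conj {S : Type*} [InverseSemigroup S] {e : S} (he : IsIdem e) (s : S) :
    s * e * s⁻¹ * s = s * e := by
  have hs : IsIdem (s⁻¹ * s) := by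
    unfold IsIdem
    rw [← mul_assoc, InverseSemigroup.inv_mul_inv]
  rw [mul_assoc (s * e), mul_assoc s, aux_idem_comm he hs, ← mul_assoc, ← mul_assoc,
    InverseSemigroup.mul_inv_mul]

/-- If `x ∼ₗ y` in a supported left `S`-action, then `s x ∼ₗ s y`. -/
theorem statement0 {S X : Type*} [InverseSemigroup S] (M : SupportedAction S X)
    (x y : X) (h : M.LCompat x y) (s : S) :
    M.LCompat (M.act s x) (M.act s y) := by
  unfold SupportedAction.LCompat at h ⊢
  rw [M.p_conj, M.p_conj, ← M.act_mul, ← M.act_mul, aux_conj (M.p_idem x),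
    aux_conj (M.p_idem y), M.act_mul, M.act_mul, h]

end PseudogroupMorita
end

section
/- Let S be an inverse semigroup and let (X, p) be a supported left S-action. If s, t ∈ S are left compatible (i.e. s⁻¹t is an idempotent, equivalently ss⁻¹t = tt⁻¹s), then for every x ∈ X the elements sx and tx are left compatible (i.e. p(sx)(tx) = p(tx)(sx)). -/
namespace PseudogroupMorita

section Helpers

variable {S : Type*} [InverseSemigroup S]

theorem idem_inv {e : S} (h : IsIdem e) : e⁻¹ = e := by
  unfold IsIdem at h
  exact (InverseSemigroup.inv_unique e e (by rw [h, h]) (by rw [h, h])).symm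

theorem idem_mul {e f : S} (he : IsIdem e) (hf : IsIdem f) : IsIdem (e * f) := by
  have h1 := InverseSemigroup.mul_inv_mul (e * f)
  have h2 := InverseSemigroup.inv_mul_inv (e * f)
  have he' : ∀ z, e * (e * z) = e * z := fun z => by rw [← mul_assoc, he]
  have hf' : ∀ z, f * (f * z) = f * z := fun z => by rw [← mul_assoc, hf]
  have h3 : f * (e * f)⁻¹ * e = (e * f)⁻¹ := by
    generalize hx : (e * f)⁻¹ = x at h1 h2
    have h2' : ∀ z, x * (e * (f * (x * z))) = x * z := fun z => by
      conv_rhs => rw [← h2]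
      simp only [mul_assoc]
    refine (InverseSemigroup.inv_unique (e * f) _ ?_ ?_).trans hx
    · simp only [mul_assoc, he', hf'] at h1 ⊢
      exact h1
    · simp only [mul_assoc, he', hf', h2']
  have h4 : IsIdem (e * f)⁻¹ := by
    unfold IsIdem
    calc (e * f)⁻¹ * (e * f)⁻¹ = (f * (e * f)⁻¹ * e) * (f * (e * f)⁻¹ * e) := by rw [h3]
      _ = f * ((e * f)⁻¹ * (e * f) * (e * f)⁻¹) * e := by simp only [mul_assoc]
      _ = (e * f)⁻¹ := by rw [h2, h3]
  have h5 : e * f = (e * f)⁻¹ := by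
    exact (InverseSemigroup.inv_unique _ _ h2 h1).trans (idem_inv h4)
  rw [h5]; exact h4

theorem idem_comm {e f : S} (he : IsIdem e) (hf : IsIdem f) : e * f = f * e := by
  have h1 := idem_mul he hf
  have h2 := idem_mul hf he
  have he' : ∀ z, e * (e * z) = e * z := fun z => by rw [← mul_assoc, he]
  have hf' : ∀ z, f * (f * z) = f * z := fun z => by rw [← mul_assoc, hf]
  have h3 : f * e = (e * f)⁻¹ := by
    unfold IsIdem at h1 h2
    apply InverseSemigroup.inv_unique
    · simp only [mul_assoc, he', hf'] at h1 ⊢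
      exact h1
    · simp only [mul_assoc, he', hf'] at h2 ⊢
      exact h2
  rw [h3, idem_inv h1]

theorem idem_mul_inv (a : S) : IsIdem (a * a⁻¹) := by
  unfold IsIdem
  rw [← mul_assoc, InverseSemigroup.mul_inv_mul]

theorem leftCompat_symm_eq {s t : S} (h : LeftCompat s t) : t⁻¹ * s = s⁻¹ * t := by
  have hc := idem_comm (idem_mul_inv s) (idem_mul_inv t)
  rw [← idem_inv h]
  apply InverseSemigroup.inv_unique
  · calc s⁻¹ * t * (t⁻¹ * s) * (s⁻¹ * t) = s⁻¹ * ((t * t⁻¹) * (s * s⁻¹)) * t := by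
          simp only [mul_assoc]
      _ = (s⁻¹ * s * s⁻¹) * (t * t⁻¹ * t) := by rw [← hc]; simp only [mul_assoc]
      _ = s⁻¹ * t := by
          rw [InverseSemigroup.inv_mul_inv, InverseSemigroup.mul_inv_mul]
  · calc t⁻¹ * s * (s⁻¹ * t) * (t⁻¹ * s) = t⁻¹ * ((s * s⁻¹) * (t * t⁻¹)) * s := by
          simp only [mul_assoc]
      _ = (t⁻¹ * t * t⁻¹) * (s * s⁻¹ * s) := by rw [hc]; simp only [mul_assoc]
      _ = t⁻¹ * s := by
          rw [InverseSemigroup.inv_mul_inv, InverseSemigroup.mul_inv_mul]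

theorem leftCompat_mul_eq {s t : S} (h : LeftCompat s t) :
    s * (s⁻¹ * t) = t * (s⁻¹ * t) := by
  have hc := idem_comm (idem_mul_inv s) (idem_mul_inv t)
  have hs := leftCompat_symm_eq h
  calc s * (s⁻¹ * t) = s * (s⁻¹ * (t * t⁻¹ * t)) := by rw [InverseSemigroup.mul_inv_mul]
    _ = ((s * s⁻¹) * (t * t⁻¹)) * t := by simp only [mul_assoc]
    _ = t * ((t⁻¹ * s) * (s⁻¹ * t)) := by rw [hc]; simp only [mul_assoc]
    _ = t * (s⁻¹ * t) := by rw [hs, h]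

end Helpers

/-- If `s ∼ₗ t` in `S`, then `s x ∼ₗ t x` in any supported left `S`-action. -/
theorem statement1 {S X : Type*} [InverseSemigroup S] (M : SupportedAction S X)
    (s t : S) (h : LeftCompat s t) (x : X) :
    M.LCompat (M.act s x) (M.act t x) := by
  unfold SupportedAction.LCompat
  have hp := idem_comm (M.p_idem x) h
  have hs := leftCompat_symm_eq h
  rw [M.p_conj, M.p_conj, ← M.act_mul, ← M.act_mul, mul_assoc, mul_assoc, mul_assoc, mul_assoc,
    hs, hp, ← mul_assoc, ← mul_assoc t, leftCompat_mul_eq h]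

end PseudogroupMorita
end

section
/- Let S and T be inverse semigroups and let X be an (S,T)-biaction with inner products ⟨-,-⟩ : X × X → S and [-,-] : X × X → T. If x, y ∈ X are such that ⟨x,y⟩ is an idempotent of S and [x,y] is an idempotent of T, then x and y are compatible: ⟨x,x⟩y = ⟨y,y⟩x and x[y,y] = y[x,x]. -/
namespace PseudogroupMorita

/-- In an `(S,T)`-biaction, if `⟨x,y⟩` and `[x,y]` are both idempotent
then `x` and `y` are compatible: `⟨x,x⟩ y = ⟨y,y⟩ x` and `x [y,y] = y [x,x]`. -/
theorem statement9 {S T X : Type*} [InverseSemigroup S] [InverseSemigroup T]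
    (B : Biaction S T X) (x y : X)
    (h1 : IsIdem (B.ip x y)) (h2 : IsIdem (B.iq x y)) :
    B.actL (B.ip x x) y = B.actL (B.ip y y) x ∧
    B.actR x (B.iq y y) = B.actR y (B.iq x x) := by
  have he : B.ip y x = B.ip x y := by
    rw [B.ip_symm x y]
    exact (InverseSemigroup.inv_unique _ _ (by rw [h1, h1]) (by rw [h1, h1])).symm
  have hf : B.iq y x = B.iq x y := by
    rw [B.iq_symm x y]
    exact (InverseSemigroup.inv_unique _ _ (by rw [h2, h2]) (by rw [h2, h2])).symm
  have a1 : B.iq x y * B.iq y y = B.iq x y := by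
    rw [← B.iq_actR, B.iq_self_act]
  -- uniqueness of inverses gives `q(y) [x,y] = [x,y]`
  have a2 : B.iq y y * B.iq x y = B.iq x y := by
    have k : B.iq x y * (B.iq y y * B.iq x y) = B.iq x y := by
      rw [← mul_assoc, a1, h2]
    have k2 : B.iq y y * B.iq x y * B.iq x y = B.iq y y * B.iq x y := by
      rw [mul_assoc, h2]
    have := InverseSemigroup.inv_unique (B.iq x y) (B.iq y y * B.iq x y)
      (by rw [k, h2]) (by rw [k2, mul_assoc, k])
    rw [this, ← B.iq_symm, hf]
  have b1 : B.actL (B.ip x x) y = B.actR x (B.iq x y) := B.ip_iq_assoc _ _ _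
  have b2 : B.actL (B.ip y y) x = B.actR y (B.iq x y) := by rw [B.ip_iq_assoc, hf]
  have c1 : B.actR x (B.iq y y) = B.actR y (B.iq x y) := by
    rw [← B.ip_iq_assoc, ← he, B.ip_iq_assoc]
  have c2 : B.actR y (B.iq x x) = B.actR x (B.iq x y) := by
    rw [← B.ip_iq_assoc, he, B.ip_iq_assoc, hf]
  have d : B.actR y (B.iq x y) = B.actR x (B.iq x y) := by
    calc B.actR y (B.iq x y) = B.actR (B.actR y (B.iq x y)) (B.iq x y) := by
          rw [← B.actR_mul, h2]
      _ = B.actR x (B.iq x y) := by rw [← c1, ← B.actR_mul, a2]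
  exact ⟨by rw [b1, b2, d], by rw [c1, c2, d]⟩

end PseudogroupMorita
end
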